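/- (Proposition 3.3(iv)) Viewing X1, X2, X3 as smooth maps Ω → ℝ⁶ on the open set Ω := {(x,y) ∈ ℝ⁶ : x1, x2, x3 > 0}, for every p ∈ M̃⁴ and all distinct i, j ∈ {1,2,3} the Lie bracket vanishes at p: DX_j(p)[X_i(p)] - DX_i(p)[X_j(p)] = 0, where DX(p) denotes the Fréchet derivative of X at p. -/

import Mathlib

noncomputable section

/-- `ℝ⁶` with its Euclidean inner product; coordinates `p 0, p 1, p 2` are `x₁, x₂, x₃`
and `p 3, p 4, p 5` are `y₁, y₂, y₃`. -/
abbrev E6 := EuclideanSpace ℝ (Fin 6)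

/-- The point of `ℝ⁶` with the given six coordinates. -/
noncomputable def mk6 (a b c d e f : ℝ) : E6 :=
  (EuclideanSpace.equiv (Fin 6) ℝ).symm ![a, b, c, d, e, f]

/-- The polynomial `F` of Proposition 3.2. -/
noncomputable def Fq (p : E6) : ℝ :=
  9 * (p 0) ^ 2 * (p 2) ^ 8 * ((p 1) ^ 2 + (p 2) ^ 2) * (p 3) ^ 2
    + 9 * (p 0) ^ 8 * (p 1) ^ 2 * ((p 0) ^ 2 - (p 2) ^ 2) * (p 4) ^ 2
    - 9 * (p 1) ^ 8 * (p 2) ^ 2 * ((p 0) ^ 2 + (p 1) ^ 2) * (p 5) ^ 2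
    - (p 0) ^ 2 * (p 1) ^ 2 * (p 2) ^ 2 *
      (2 * (p 0) ^ 2 * (p 1) ^ 4 - 2 * (p 0) ^ 2 * (p 2) ^ 4 - 2 * (p 1) ^ 2 * (p 2) ^ 4
        - (p 0) ^ 2 * (p 1) ^ 2 * (p 2) ^ 2)

/-- The polynomial `G` of Proposition 3.2. -/
noncomputable def Gq (p : E6) : ℝ := (p 1) ^ 2 - (p 0) ^ 2 - (p 2) ^ 2

/-- The algebraic variety `M⁴`. -/
def M4 : Set E6 :=
  {p | Fq p = 0 ∧ Gq p = 0 ∧ 0 < p 0 ∧ 0 < p 1 ∧ 0 < p 2 ∧ ¬(p 3 = 0 ∧ p 4 = 0 ∧ p 5 = 0)}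

/-- The half line `ℓ₊`: points of `M⁴` with `x = s(1, √2, 1)`, `s > 0`, `y = (0, 1, 0)`. -/
def ellP : Set E6 :=
  {p ∈ M4 | ∃ s : ℝ, 0 < s ∧ p 0 = s ∧ p 1 = s * Real.sqrt 2 ∧ p 2 = s ∧
    p 3 = 0 ∧ p 4 = 1 ∧ p 5 = 0}

/-- The half line `ℓ₋`: points of `M⁴` with `x = s(1, √2, 1)`, `s > 0`, `y = (0, -1, 0)`. -/
def ellM : Set E6 :=
  {p ∈ M4 | ∃ s : ℝ, 0 < s ∧ p 0 = s ∧ p 1 = s * Real.sqrt 2 ∧ p 2 = s ∧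
    p 3 = 0 ∧ p 4 = -1 ∧ p 5 = 0}

/-- The regular part `M̃⁴ = M⁴ \ (ℓ₋ ∪ ℓ₊)`. -/
def Mt4 : Set E6 := M4 \ (ellM ∪ ellP)

/-- `A₁` of Proposition 3.3. -/
noncomputable def A1 (p : E6) : ℝ :=
  (1 / (p 1) ^ 4) * (3 * (p 1) ^ 4 - (p 2) ^ 4) * (p 3) ^ 2
    - ((p 0) ^ 6 / (p 2) ^ 8) * (3 * (p 0) ^ 2 - 2 * (p 2) ^ 2) * (p 4) ^ 2
    + ((p 1) ^ 4 / ((p 0) ^ 2 * (p 2) ^ 4)) * (3 * (p 0) ^ 2 + 2 * (p 1) ^ 2) * (p 5) ^ 2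
    + (1 / (9 * (p 2) ^ 4)) * (5 * (p 0) ^ 4 + 2 * (p 1) ^ 2 * (p 2) ^ 2)

/-- `A₂` of Proposition 3.3. -/
noncomputable def A2 (p : E6) : ℝ :=
  -((p 2) ^ 4 / ((p 0) ^ 4 * (p 1) ^ 2)) * (3 * (p 1) ^ 2 + 2 * (p 2) ^ 2) * (p 3) ^ 2
    - (1 / (p 2) ^ 4) * ((p 0) ^ 4 - 3 * (p 2) ^ 4) * (p 4) ^ 2
    - ((p 1) ^ 6 / (p 0) ^ 8) * (2 * (p 0) ^ 2 + 3 * (p 1) ^ 2) * (p 5) ^ 2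
    - (1 / (9 * (p 0) ^ 4)) * (5 * (p 1) ^ 4 - 2 * (p 0) ^ 2 * (p 2) ^ 2)

/-- `A₃` of Proposition 3.3. -/
noncomputable def A3 (p : E6) : ℝ :=
  ((p 2) ^ 6 / (p 1) ^ 8) * (2 * (p 1) ^ 2 + 3 * (p 2) ^ 2) * (p 3) ^ 2
    + ((p 0) ^ 4 / ((p 1) ^ 4 * (p 2) ^ 2)) * (2 * (p 0) ^ 2 - 3 * (p 2) ^ 2) * (p 4) ^ 2
    + (1 / (p 0) ^ 4) * (3 * (p 0) ^ 4 - (p 1) ^ 4) * (p 5) ^ 2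
    + (1 / (9 * (p 1) ^ 4)) * (5 * (p 2) ^ 4 + 2 * (p 0) ^ 2 * (p 1) ^ 2)

/-- The vector field `X₁` of Proposition 3.3. -/
noncomputable def X1 (p : E6) : E6 :=
  mk6 ((1 / (p 1) ^ 4) * (((p 1) ^ 4 + (p 1) ^ 2 * (p 2) ^ 2 + (p 2) ^ 4) * p 0 * p 3))
      ((1 / (p 1) ^ 4) * ((p 1) ^ 5 * p 3))
      ((1 / (p 1) ^ 4) * ((p 2) ^ 5 * p 3))
      ((1 / (p 1) ^ 4) * ((p 1) ^ 4 * A1 p))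
      ((1 / (p 1) ^ 4) * (2 * (p 0) ^ 2 * (p 1) ^ 2 * p 3 * p 4))
      ((1 / (p 1) ^ 4) * ((8 * (p 2) ^ 2 + 2 * (p 0) ^ 2) * (p 2) ^ 2 * p 3 * p 5))

/-- The vector field `X₂` of Proposition 3.3. -/
noncomputable def X2 (p : E6) : E6 :=
  mk6 ((1 / (p 2) ^ 4) * ((p 0) ^ 5 * p 4))
      ((1 / (p 2) ^ 4) * (((p 0) ^ 4 - (p 0) ^ 2 * (p 2) ^ 2 + (p 2) ^ 4) * p 1 * p 4))
      ((1 / (p 2) ^ 4) * ((p 2) ^ 5 * p 4))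
      ((1 / (p 2) ^ 4) * ((8 * (p 0) ^ 2 - 2 * (p 1) ^ 2) * (p 0) ^ 2 * p 3 * p 4))
      ((1 / (p 2) ^ 4) * ((p 2) ^ 4 * A2 p))
      ((1 / (p 2) ^ 4) * (2 * (p 1) ^ 2 * (p 2) ^ 2 * p 4 * p 5))

/-- The vector field `X₃` of Proposition 3.3. -/
noncomputable def X3 (p : E6) : E6 :=
  mk6 ((1 / (p 0) ^ 4) * ((p 0) ^ 5 * p 5))
      ((1 / (p 0) ^ 4) * ((p 1) ^ 5 * p 5))
      ((1 / (p 0) ^ 4) * (((p 0) ^ 4 + (p 0) ^ 2 * (p 1) ^ 2 + (p 1) ^ 4) * p 2 * p 5))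
      ((1 / (p 0) ^ 4) * (-2 * (p 0) ^ 2 * (p 2) ^ 2 * p 3 * p 5))
      ((1 / (p 0) ^ 4) * ((8 * (p 1) ^ 2 - 2 * (p 2) ^ 2) * (p 1) ^ 2 * p 4 * p 5))
      ((1 / (p 0) ^ 4) * ((p 0) ^ 4 * A3 p))

/-- The indexed family `X₁, X₂, X₃`. -/
noncomputable def Xv : Fin 3 → E6 → E6 := ![X1, X2, X3]

/-- A coordinate of a directional derivative is the derivative of that coordinate along a line. -/
lemma fderiv_apply_eq_of_hasDerivAt {f : E6 → E6} {p v : E6} {k : Fin 6} {d : ℝ}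
    (hf : DifferentiableAt ℝ f p) (hd : HasDerivAt (fun t : ℝ => f (p + t • v) k) d 0) :
    fderiv ℝ f p v k = d := by
  have hk := hasFDerivWithinAt_univ.1
    (hasFDerivWithinAt_euclidean.1 hf.hasFDerivAt.hasFDerivWithinAt k)
  exact (hk.hasLineDerivAt v).unique hd

lemma hasDerivAt_line_apply (p v : E6) (k : Fin 6) :
    HasDerivAt (fun t : ℝ => (p + t • v) k) (v k) 0 := by
  simpa using ((hasDerivAt_id (0 : ℝ)).mul_const (v k)).const_add (p k)

set_option maxHeartbeats 1600000 in
/-- The directional derivative of `X1`, coordinate by coordinate. -/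
lemma fderiv_X1_apply {p : E6} (h0 : p 0 ≠ 0) (h1 : p 1 ≠ 0) (h2 : p 2 ≠ 0) (v : E6) :
    fderiv ℝ X1 p v = mk6
      ((p 2 ^ 4 * p 3 / p 1 ^ 4 + p 2 ^ 2 * p 3 / p 1 ^ 2 + p 3) * v 0 +
      (-4 * p 0 * p 2 ^ 4 * p 3 / p 1 ^ 5 - 2 * p 0 * p 2 ^ 2 * p 3 / p 1 ^ 3) * v 1 +
      (4 * p 0 * p 2 ^ 3 * p 3 / p 1 ^ 4 + 2 * p 0 * p 2 * p 3 / p 1 ^ 2) * v 2 +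
      (p 0 * p 2 ^ 4 / p 1 ^ 4 + p 0 * p 2 ^ 2 / p 1 ^ 2 + p 0) * v 3)
      (p 3 * v 1 + p 1 * v 3)
      ((-4 * p 2 ^ 5 * p 3 / p 1 ^ 5) * v 1 + 5 * p 2 ^ 4 * p 3 / p 1 ^ 4 * v 2 +
      p 2 ^ 5 / p 1 ^ 4 * v 3)
      ((-4 * p 1 ^ 6 * p 5 ^ 2 / (p 0 ^ 3 * p 2 ^ 4) + 20 * p 0 ^ 3 / (9 * p 2 ^ 4)
      + 12 * p 0 ^ 5 * p 4 ^ 2 / p 2 ^ 6 - 24 * p 0 ^ 7 * p 4 ^ 2 / p 2 ^ 8) * v 0 +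
      (12 * p 1 ^ 5 * p 5 ^ 2 / (p 0 ^ 2 * p 2 ^ 4) + 4 * p 2 ^ 4 * p 3 ^ 2 / p 1 ^ 5
      + 4 * p 1 / (9 * p 2 ^ 2) + 12 * p 1 ^ 3 * p 5 ^ 2 / p 2 ^ 4) * v 1 +
      (-8 * p 1 ^ 6 * p 5 ^ 2 / (p 0 ^ 2 * p 2 ^ 5) - 4 * p 2 ^ 3 * p 3 ^ 2 / p 1 ^ 4
      - 4 * p 1 ^ 2 / (9 * p 2 ^ 3) - 12 * p 1 ^ 4 * p 5 ^ 2 / p 2 ^ 5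
      - 20 * p 0 ^ 4 / (9 * p 2 ^ 5) - 12 * p 0 ^ 6 * p 4 ^ 2 / p 2 ^ 7
      + 24 * p 0 ^ 8 * p 4 ^ 2 / p 2 ^ 9) * v 2 + (-2 * p 2 ^ 4 * p 3 / p 1 ^ 4 + 6 * p 3) * v 3 +
      (4 * p 0 ^ 6 * p 4 / p 2 ^ 6 - 6 * p 0 ^ 8 * p 4 / p 2 ^ 8) * v 4 +
      (4 * p 1 ^ 6 * p 5 / (p 0 ^ 2 * p 2 ^ 4) + 6 * p 1 ^ 4 * p 5 / p 2 ^ 4) * v 5)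
      (4 * p 0 * p 3 * p 4 / p 1 ^ 2 * v 0 + (-4 * p 0 ^ 2 * p 3 * p 4 / p 1 ^ 3) * v 1 +
      2 * p 0 ^ 2 * p 4 / p 1 ^ 2 * v 3 + 2 * p 0 ^ 2 * p 3 / p 1 ^ 2 * v 4)
      (4 * p 0 * p 2 ^ 2 * p 3 * p 5 / p 1 ^ 4 * v 0 + (-32 * p 2 ^ 4 * p 3 * p 5 / p 1 ^ 5
      - 8 * p 0 ^ 2 * p 2 ^ 2 * p 3 * p 5 / p 1 ^ 5) * v 1 + (32 * p 2 ^ 3 * p 3 * p 5 / p 1 ^ 4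
      + 4 * p 0 ^ 2 * p 2 * p 3 * p 5 / p 1 ^ 4) * v 2 + (8 * p 2 ^ 4 * p 5 / p 1 ^ 4
      + 2 * p 0 ^ 2 * p 2 ^ 2 * p 5 / p 1 ^ 4) * v 3 + (8 * p 2 ^ 4 * p 3 / p 1 ^ 4
      + 2 * p 0 ^ 2 * p 2 ^ 2 * p 3 / p 1 ^ 4) * v 5) := by
  have hX : DifferentiableAt ℝ X1 p := by
    rw [differentiableAt_euclidean]
    intro k
    fin_cases k <;> simp only [X1, A1, mk6] <;> simp <;>
      fun_prop (disch := simp [h0, h1, h2])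
  have H := hasDerivAt_line_apply p v
  ext k
  apply fderiv_apply_eq_of_hasDerivAt hX
  fin_cases k <;> simp only [X1, A1, mk6] <;>
    simp only [EuclideanSpace.equiv, PiLp.continuousLinearEquiv_symm_apply, Matrix.cons_val,
      Fin.reduceFinMk, Fin.zero_eta, Fin.mk_one] <;>
  · refine HasDerivAt.congr_deriv (by
      repeat' first
        | exact hasDerivAt_const _ _
        | exact H _
        | with_reducible apply HasDerivAt.fun_add
        | with_reducible apply HasDerivAt.fun_sub
        | with_reducible apply HasDerivAt.fun_neg
        | with_reducible apply HasDerivAt.fun_mul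
        | with_reducible apply HasDerivAt.fun_div
        | with_reducible apply HasDerivAt.fun_pow
        | simp [h0, h1, h2]) ?_
    simp only [zero_smul, add_zero]
    field_simp
    ring

set_option maxHeartbeats 1600000 in
/-- The directional derivative of `X2`, coordinate by coordinate. -/
lemma fderiv_X2_apply {p : E6} (h0 : p 0 ≠ 0) (h1 : p 1 ≠ 0) (h2 : p 2 ≠ 0) (v : E6) :
    fderiv ℝ X2 p v = mk6
      (5 * p 0 ^ 4 * p 4 / p 2 ^ 4 * v 0 + (-4 * p 0 ^ 5 * p 4 / p 2 ^ 5) * v 2 +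
      p 0 ^ 5 / p 2 ^ 4 * v 4)
      ((-2 * p 0 * p 1 * p 4 / p 2 ^ 2 + 4 * p 0 ^ 3 * p 1 * p 4 / p 2 ^ 4) * v 0 + (p 4
      - p 0 ^ 2 * p 4 / p 2 ^ 2 + p 0 ^ 4 * p 4 / p 2 ^ 4) * v 1 +
      (2 * p 0 ^ 2 * p 1 * p 4 / p 2 ^ 3 - 4 * p 0 ^ 4 * p 1 * p 4 / p 2 ^ 5) * v 2 + (p 1
      - p 0 ^ 2 * p 1 / p 2 ^ 2 + p 0 ^ 4 * p 1 / p 2 ^ 4) * v 4)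
      (p 4 * v 2 + p 2 * v 4)
      ((-4 * p 0 * p 1 ^ 2 * p 3 * p 4 / p 2 ^ 4 + 32 * p 0 ^ 3 * p 3 * p 4 / p 2 ^ 4) * v 0 +
      (-4 * p 0 ^ 2 * p 1 * p 3 * p 4 / p 2 ^ 4) * v 1 +
      (8 * p 0 ^ 2 * p 1 ^ 2 * p 3 * p 4 / p 2 ^ 5 - 32 * p 0 ^ 4 * p 3 * p 4 / p 2 ^ 5) * v 2 +
      (-2 * p 0 ^ 2 * p 1 ^ 2 * p 4 / p 2 ^ 4 + 8 * p 0 ^ 4 * p 4 / p 2 ^ 4) * v 3 +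
      (-2 * p 0 ^ 2 * p 1 ^ 2 * p 3 / p 2 ^ 4 + 8 * p 0 ^ 4 * p 3 / p 2 ^ 4) * v 4)
      ((24 * p 1 ^ 8 * p 5 ^ 2 / p 0 ^ 9 + 12 * p 1 ^ 6 * p 5 ^ 2 / p 0 ^ 7
      + 8 * p 2 ^ 6 * p 3 ^ 2 / (p 0 ^ 5 * p 1 ^ 2) + 12 * p 2 ^ 4 * p 3 ^ 2 / p 0 ^ 5
      + 20 * p 1 ^ 4 / (9 * p 0 ^ 5) - 4 * p 2 ^ 2 / (9 * p 0 ^ 3)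
      - 4 * p 0 ^ 3 * p 4 ^ 2 / p 2 ^ 4) * v 0 + (-24 * p 1 ^ 7 * p 5 ^ 2 / p 0 ^ 8
      - 12 * p 1 ^ 5 * p 5 ^ 2 / p 0 ^ 6 + 4 * p 2 ^ 6 * p 3 ^ 2 / (p 0 ^ 4 * p 1 ^ 3)
      - 20 * p 1 ^ 3 / (9 * p 0 ^ 4)) * v 1 + (-12 * p 2 ^ 5 * p 3 ^ 2 / (p 0 ^ 4 * p 1 ^ 2)
      - 12 * p 2 ^ 3 * p 3 ^ 2 / p 0 ^ 4 + 4 * p 2 / (9 * p 0 ^ 2)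
      + 4 * p 0 ^ 4 * p 4 ^ 2 / p 2 ^ 5) * v 2 + (-4 * p 2 ^ 6 * p 3 / (p 0 ^ 4 * p 1 ^ 2)
      - 6 * p 2 ^ 4 * p 3 / p 0 ^ 4) * v 3 + (6 * p 4 - 2 * p 0 ^ 4 * p 4 / p 2 ^ 4) * v 4 +
      (-6 * p 1 ^ 8 * p 5 / p 0 ^ 8 - 4 * p 1 ^ 6 * p 5 / p 0 ^ 6) * v 5)
      (4 * p 1 * p 4 * p 5 / p 2 ^ 2 * v 1 + (-4 * p 1 ^ 2 * p 4 * p 5 / p 2 ^ 3) * v 2 +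
      2 * p 1 ^ 2 * p 5 / p 2 ^ 2 * v 4 + 2 * p 1 ^ 2 * p 4 / p 2 ^ 2 * v 5) := by
  have hX : DifferentiableAt ℝ X2 p := by
    rw [differentiableAt_euclidean]
    intro k
    fin_cases k <;> simp only [X2, A2, mk6] <;> simp <;>
      fun_prop (disch := simp [h0, h1, h2])
  have H := hasDerivAt_line_apply p v
  ext k
  apply fderiv_apply_eq_of_hasDerivAt hX
  fin_cases k <;> simp only [X2, A2, mk6] <;>
    simp only [EuclideanSpace.equiv, PiLp.continuousLinearEquiv_symm_apply, Matrix.cons_val,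
      Fin.reduceFinMk, Fin.zero_eta, Fin.mk_one] <;>
  · refine HasDerivAt.congr_deriv (by
      repeat' first
        | exact hasDerivAt_const _ _
        | exact H _
        | with_reducible apply HasDerivAt.fun_add
        | with_reducible apply HasDerivAt.fun_sub
        | with_reducible apply HasDerivAt.fun_neg
        | with_reducible apply HasDerivAt.fun_mul
        | with_reducible apply HasDerivAt.fun_div
        | with_reducible apply HasDerivAt.fun_pow
        | simp [h0, h1, h2]) ?_
    simp only [zero_smul, add_zero]
    field_simp
    ring

set_option maxHeartbeats 1600000 in
/-- The directional derivative of `X3`, coordinate by coordinate. -/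
lemma fderiv_X3_apply {p : E6} (h0 : p 0 ≠ 0) (h1 : p 1 ≠ 0) (h2 : p 2 ≠ 0) (v : E6) :
    fderiv ℝ X3 p v = mk6
      (p 5 * v 0 + p 0 * v 5)
      ((-4 * p 1 ^ 5 * p 5 / p 0 ^ 5) * v 0 + 5 * p 1 ^ 4 * p 5 / p 0 ^ 4 * v 1 +
      p 1 ^ 5 / p 0 ^ 4 * v 5)
      ((-4 * p 1 ^ 4 * p 2 * p 5 / p 0 ^ 5 - 2 * p 1 ^ 2 * p 2 * p 5 / p 0 ^ 3) * v 0 +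
      (4 * p 1 ^ 3 * p 2 * p 5 / p 0 ^ 4 + 2 * p 1 * p 2 * p 5 / p 0 ^ 2) * v 1 +
      (p 1 ^ 4 * p 5 / p 0 ^ 4 + p 1 ^ 2 * p 5 / p 0 ^ 2 + p 5) * v 2 + (p 1 ^ 4 * p 2 / p 0 ^ 4
      + p 1 ^ 2 * p 2 / p 0 ^ 2 + p 2) * v 5)
      (4 * p 2 ^ 2 * p 3 * p 5 / p 0 ^ 3 * v 0 + (-4 * p 2 * p 3 * p 5 / p 0 ^ 2) * v 2 +
      (-2 * p 2 ^ 2 * p 5 / p 0 ^ 2) * v 3 + (-2 * p 2 ^ 2 * p 3 / p 0 ^ 2) * v 5)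
      ((8 * p 1 ^ 2 * p 2 ^ 2 * p 4 * p 5 / p 0 ^ 5 - 32 * p 1 ^ 4 * p 4 * p 5 / p 0 ^ 5) * v 0 +
      (-4 * p 1 * p 2 ^ 2 * p 4 * p 5 / p 0 ^ 4 + 32 * p 1 ^ 3 * p 4 * p 5 / p 0 ^ 4) * v 1 +
      (-4 * p 1 ^ 2 * p 2 * p 4 * p 5 / p 0 ^ 4) * v 2 + (-2 * p 1 ^ 2 * p 2 ^ 2 * p 5 / p 0 ^ 4
      + 8 * p 1 ^ 4 * p 5 / p 0 ^ 4) * v 4 + (-2 * p 1 ^ 2 * p 2 ^ 2 * p 4 / p 0 ^ 4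
      + 8 * p 1 ^ 4 * p 4 / p 0 ^ 4) * v 5)
      ((4 * p 1 ^ 4 * p 5 ^ 2 / p 0 ^ 5 + 4 * p 0 / (9 * p 1 ^ 2)
      - 12 * p 0 ^ 3 * p 4 ^ 2 / p 1 ^ 4 + 12 * p 0 ^ 5 * p 4 ^ 2 / (p 1 ^ 4 * p 2 ^ 2)) * v 0 +
      (-4 * p 1 ^ 3 * p 5 ^ 2 / p 0 ^ 4 - 24 * p 2 ^ 8 * p 3 ^ 2 / p 1 ^ 9
      - 12 * p 2 ^ 6 * p 3 ^ 2 / p 1 ^ 7 - 20 * p 2 ^ 4 / (9 * p 1 ^ 5)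
      - 4 * p 0 ^ 2 / (9 * p 1 ^ 3) + 12 * p 0 ^ 4 * p 4 ^ 2 / p 1 ^ 5
      - 8 * p 0 ^ 6 * p 4 ^ 2 / (p 1 ^ 5 * p 2 ^ 2)) * v 1 + (24 * p 2 ^ 7 * p 3 ^ 2 / p 1 ^ 8
      + 12 * p 2 ^ 5 * p 3 ^ 2 / p 1 ^ 6 + 20 * p 2 ^ 3 / (9 * p 1 ^ 4)
      - 4 * p 0 ^ 6 * p 4 ^ 2 / (p 1 ^ 4 * p 2 ^ 3)) * v 2 + (6 * p 2 ^ 8 * p 3 / p 1 ^ 8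
      + 4 * p 2 ^ 6 * p 3 / p 1 ^ 6) * v 3 + (-6 * p 0 ^ 4 * p 4 / p 1 ^ 4
      + 4 * p 0 ^ 6 * p 4 / (p 1 ^ 4 * p 2 ^ 2)) * v 4 + (-2 * p 1 ^ 4 * p 5 / p 0 ^ 4
      + 6 * p 5) * v 5) := by
  have hX : DifferentiableAt ℝ X3 p := by
    rw [differentiableAt_euclidean]
    intro k
    fin_cases k <;> simp only [X3, A3, mk6] <;> simp <;>
      fun_prop (disch := simp [h0, h1, h2])
  have H := hasDerivAt_line_apply p v
  ext k
  apply fderiv_apply_eq_of_hasDerivAt hX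
  fin_cases k <;> simp only [X3, A3, mk6] <;>
    simp only [EuclideanSpace.equiv, PiLp.continuousLinearEquiv_symm_apply, Matrix.cons_val,
      Fin.reduceFinMk, Fin.zero_eta, Fin.mk_one] <;>
  · refine HasDerivAt.congr_deriv (by
      repeat' first
        | exact hasDerivAt_const _ _
        | exact H _
        | with_reducible apply HasDerivAt.fun_add
        | with_reducible apply HasDerivAt.fun_sub
        | with_reducible apply HasDerivAt.fun_neg
        | with_reducible apply HasDerivAt.fun_mul
        | with_reducible apply HasDerivAt.fun_div
        | with_reducible apply HasDerivAt.fun_pow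
        | simp [h0, h1, h2]) ?_
    simp only [zero_smul, add_zero]
    field_simp
    ring

lemma bracket_X1_X2 {p : E6} (hF : Fq p = 0) (hG : Gq p = 0)
    (h0 : p 0 ≠ 0) (h1 : p 1 ≠ 0) (h2 : p 2 ≠ 0) :
    fderiv ℝ X2 p (X1 p) - fderiv ℝ X1 p (X2 p) = 0 := by
  rw [fderiv_X1_apply h0 h1 h2, fderiv_X2_apply h0 h1 h2]
  unfold Fq at hF
  unfold Gq at hG
  ext k
  fin_cases k <;> simp [mk6, X1, X2, A1, A2]
  · linear_combination (norm := (field_simp; ring))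
      (4 * p 0 ^ 3 * p 3 * p 4 / p 1 ^ 4 + 4 * p 0 ^ 3 * p 3 * p 4 / (p 1 ^ 2 * p 2 ^ 2)
      + 2 * p 0 ^ 3 * p 3 * p 4 / p 2 ^ 4 - 2 * p 0 ^ 5 * p 3 * p 4 / (p 1 ^ 2 * p 2 ^ 4)) * hG
  · linear_combination (norm := (field_simp; ring))
      (2 * p 0 ^ 2 * p 1 * p 3 * p 4 / p 2 ^ 4 - 2 * p 0 ^ 4 * p 3 * p 4 / (p 1 * p 2 ^ 4)) * hG
  · linear_combination (norm := (field_simp; ring))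
      (4 * p 0 ^ 2 * p 2 * p 3 * p 4 / p 1 ^ 4) * hG
  · linear_combination (norm := (field_simp; ring))
      (10 * p 4 / (9 * p 1 ^ 4 * p 2 ^ 8) + 10 * p 0 ^ 2 * p 4 / (9 * p 1 ^ 4 * p 2 ^ 10)) * hF +
      (4 * p 1 ^ 6 * p 4 * p 5 ^ 2 / (p 0 ^ 2 * p 2 ^ 6) - 22 * p 1 ^ 6 * p 4 * p 5 ^ 2 / p 2 ^ 8
      + 6 * p 0 ^ 2 * p 3 ^ 2 * p 4 / p 1 ^ 4 + 6 * p 0 ^ 2 * p 3 ^ 2 * p 4 / (p 1 ^ 2 * p 2 ^ 2)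
      + 20 * p 0 ^ 2 * p 4 / (9 * p 2 ^ 4) - 2 * p 0 ^ 2 * p 3 ^ 2 * p 4 / p 2 ^ 4
      + 16 * p 0 ^ 2 * p 1 ^ 2 * p 4 / (9 * p 2 ^ 6)
      - 22 * p 0 ^ 2 * p 1 ^ 4 * p 4 * p 5 ^ 2 / p 2 ^ 8
      + 20 * p 0 ^ 4 * p 4 / (9 * p 1 ^ 2 * p 2 ^ 4)
      - 16 * p 0 ^ 4 * p 3 ^ 2 * p 4 / (p 1 ^ 2 * p 2 ^ 4) + 2 * p 0 ^ 4 * p 4 / p 2 ^ 6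
      - 10 * p 0 ^ 4 * p 1 ^ 2 * p 4 / (3 * p 2 ^ 8) - 20 * p 0 ^ 6 * p 4 / (9 * p 2 ^ 8)
      - 10 * p 0 ^ 8 * p 4 ^ 3 / (p 1 ^ 2 * p 2 ^ 8) - 4 * p 0 ^ 8 * p 4 ^ 3 / p 2 ^ 10
      + 10 * p 0 ^ 10 * p 4 ^ 3 / (p 1 ^ 2 * p 2 ^ 10) + 6 * p 0 ^ 10 * p 4 ^ 3 / p 2 ^ 12) * hG
  · linear_combination (norm := (field_simp; ring))
      (10 * p 3 / (9 * p 0 ^ 6 * p 1 ^ 4 * p 2 ^ 2)) * hF +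
      (24 * p 1 ^ 4 * p 2 ^ 2 * p 3 * p 5 ^ 2 / p 0 ^ 8
      + 20 * p 1 ^ 2 * p 2 ^ 2 * p 3 * p 5 ^ 2 / p 0 ^ 6 + 4 * p 1 ^ 4 * p 3 * p 5 ^ 2 / p 0 ^ 6
      - 4 * p 2 ^ 6 * p 3 ^ 3 / (p 0 ^ 4 * p 1 ^ 4) - 6 * p 2 ^ 4 * p 3 ^ 3 / (p 0 ^ 4 * p 1 ^ 2)
      + 8 * p 2 ^ 2 * p 3 / (9 * p 0 ^ 4) + 8 * p 2 ^ 2 * p 3 / (3 * p 0 ^ 2 * p 1 ^ 2)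
      + 10 * p 3 / (3 * p 0 ^ 2) - 12 * p 0 ^ 2 * p 3 * p 4 ^ 2 / (p 1 ^ 2 * p 2 ^ 2)
      + 18 * p 0 ^ 4 * p 3 * p 4 ^ 2 / (p 1 ^ 2 * p 2 ^ 4)) * hG
  · linear_combination (norm := (field_simp; ring))
      (4 * p 3 * p 4 * p 5 / p 1 ^ 2 + 4 * p 3 * p 4 * p 5 / p 2 ^ 2
      + 28 * p 0 ^ 2 * p 3 * p 4 * p 5 / p 1 ^ 4
      + 8 * p 0 ^ 2 * p 3 * p 4 * p 5 / (p 1 ^ 2 * p 2 ^ 2)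
      + 12 * p 0 ^ 4 * p 3 * p 4 * p 5 / (p 1 ^ 4 * p 2 ^ 2)) * hG

lemma bracket_X1_X3 {p : E6} (hF : Fq p = 0) (hG : Gq p = 0)
    (h0 : p 0 ≠ 0) (h1 : p 1 ≠ 0) (h2 : p 2 ≠ 0) :
    fderiv ℝ X3 p (X1 p) - fderiv ℝ X1 p (X3 p) = 0 := by
  rw [fderiv_X1_apply h0 h1 h2, fderiv_X3_apply h0 h1 h2]
  unfold Fq at hF
  unfold Gq at hG
  ext k
  fin_cases k <;> simp [mk6, X1, X3, A1, A3]
  · linear_combination (norm := (field_simp; ring))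
      (-2 * p 2 ^ 4 * p 3 * p 5 / (p 0 * p 1 ^ 4) - 2 * p 0 * p 2 ^ 2 * p 3 * p 5 / p 1 ^ 4) * hG
  · linear_combination (norm := (field_simp; ring))
      (-4 * p 1 * p 2 ^ 2 * p 3 * p 5 / p 0 ^ 4) * hG
  · linear_combination (norm := (field_simp; ring))
      (-4 * p 2 ^ 3 * p 3 * p 5 / p 0 ^ 4 - 2 * p 2 ^ 5 * p 3 * p 5 / (p 0 ^ 2 * p 1 ^ 4)
      - 4 * p 2 ^ 3 * p 3 * p 5 / (p 0 ^ 2 * p 1 ^ 2) - 2 * p 2 ^ 3 * p 3 * p 5 / p 1 ^ 4) * hG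
  · linear_combination (norm := (field_simp; ring))
      (-10 * p 5 / (9 * p 0 ^ 4 * p 1 ^ 4 * p 2 ^ 4)
      - 10 * p 5 / (9 * p 0 ^ 2 * p 1 ^ 4 * p 2 ^ 6)) * hF +
      (14 * p 1 ^ 6 * p 5 ^ 3 / (p 0 ^ 4 * p 2 ^ 4)
      + 8 * p 2 ^ 4 * p 3 ^ 2 * p 5 / (p 0 ^ 2 * p 1 ^ 4)
      + 2 * p 2 ^ 2 * p 3 ^ 2 * p 5 / (p 0 ^ 2 * p 1 ^ 2) - 20 * p 5 / (9 * p 0 ^ 2)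
      + 4 * p 1 ^ 2 * p 5 / (9 * p 0 ^ 2 * p 2 ^ 2) + 16 * p 1 ^ 4 * p 5 ^ 3 / (p 0 ^ 2 * p 2 ^ 4)
      - 20 * p 5 / (9 * p 1 ^ 2) + 4 * p 1 ^ 2 * p 5 / (3 * p 2 ^ 4)
      - 20 * p 0 ^ 2 * p 1 ^ 2 * p 4 ^ 2 * p 5 / p 2 ^ 6
      + 10 * p 0 ^ 4 * p 4 ^ 2 * p 5 / (p 1 ^ 2 * p 2 ^ 4) - 4 * p 0 ^ 4 * p 4 ^ 2 * p 5 / p 2 ^ 6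
      + 24 * p 0 ^ 4 * p 1 ^ 2 * p 4 ^ 2 * p 5 / p 2 ^ 8
      - 10 * p 0 ^ 6 * p 4 ^ 2 * p 5 / (p 1 ^ 2 * p 2 ^ 6)) * hG
  · linear_combination (norm := (field_simp; ring))
      (12 * p 2 ^ 4 * p 3 * p 4 * p 5 / (p 0 ^ 4 * p 1 ^ 2)
      - 28 * p 2 ^ 2 * p 3 * p 4 * p 5 / p 0 ^ 4
      - 8 * p 2 ^ 2 * p 3 * p 4 * p 5 / (p 0 ^ 2 * p 1 ^ 2) + 4 * p 3 * p 4 * p 5 / p 0 ^ 2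
      + 4 * p 3 * p 4 * p 5 / p 1 ^ 2) * hG
  · linear_combination (norm := (field_simp; ring))
      (-10 * p 2 ^ 2 * p 3 / (9 * p 0 ^ 2 * p 1 ^ 12) - 10 * p 3 / (9 * p 1 ^ 12)) * hF +
      (4 * p 2 ^ 2 * p 3 * p 5 ^ 2 / p 0 ^ 4 - 16 * p 2 ^ 4 * p 3 * p 5 ^ 2 / (p 0 ^ 2 * p 1 ^ 4)
      + 14 * p 2 ^ 2 * p 3 * p 5 ^ 2 / (p 0 ^ 2 * p 1 ^ 2) - 4 * p 2 ^ 10 * p 3 ^ 3 / p 1 ^ 12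
      - 6 * p 2 ^ 8 * p 3 ^ 3 / p 1 ^ 10 - 4 * p 2 ^ 4 * p 3 / (3 * p 1 ^ 6)
      + 12 * p 2 ^ 2 * p 3 * p 5 ^ 2 / p 1 ^ 4 - 20 * p 0 ^ 2 * p 2 ^ 6 * p 3 / (9 * p 1 ^ 10)
      - 40 * p 0 ^ 2 * p 2 ^ 4 * p 3 / (9 * p 1 ^ 8) + 4 * p 0 ^ 2 * p 2 ^ 2 * p 3 / (9 * p 1 ^ 6)
      - 12 * p 0 ^ 4 * p 2 ^ 2 * p 3 * p 4 ^ 2 / p 1 ^ 8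
      + 10 * p 0 ^ 6 * p 2 ^ 2 * p 3 * p 4 ^ 2 / p 1 ^ 10 + 12 * p 0 ^ 6 * p 3 * p 4 ^ 2 / p 1 ^ 8
      + 4 * p 0 ^ 6 * p 3 * p 4 ^ 2 / (p 1 ^ 6 * p 2 ^ 2)
      - 10 * p 0 ^ 8 * p 3 * p 4 ^ 2 / p 1 ^ 10) * hG

lemma bracket_X2_X3 {p : E6} (hF : Fq p = 0) (hG : Gq p = 0)
    (h0 : p 0 ≠ 0) (h1 : p 1 ≠ 0) (h2 : p 2 ≠ 0) :
    fderiv ℝ X3 p (X2 p) - fderiv ℝ X2 p (X3 p) = 0 := by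
  rw [fderiv_X2_apply h0 h1 h2, fderiv_X3_apply h0 h1 h2]
  unfold Fq at hF
  unfold Gq at hG
  ext k
  fin_cases k <;> simp [mk6, X2, X3, A2, A3]
  · linear_combination (norm := (field_simp; ring))
      (-4 * p 0 * p 1 ^ 2 * p 4 * p 5 / p 2 ^ 4) * hG
  · linear_combination (norm := (field_simp; ring))
      (-2 * p 1 ^ 3 * p 4 * p 5 / p 0 ^ 4 + 2 * p 1 ^ 5 * p 4 * p 5 / (p 0 ^ 4 * p 2 ^ 2)
      + 4 * p 1 ^ 3 * p 4 * p 5 / (p 0 ^ 2 * p 2 ^ 2) - 4 * p 1 ^ 3 * p 4 * p 5 / p 2 ^ 4) * hG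
  · linear_combination (norm := (field_simp; ring))
      (-2 * p 1 ^ 2 * p 2 * p 4 * p 5 / p 0 ^ 4 + 2 * p 1 ^ 4 * p 4 * p 5 / (p 0 ^ 4 * p 2)) * hG
  · linear_combination (norm := (field_simp; ring))
      (4 * p 3 * p 4 * p 5 / p 0 ^ 2 + 8 * p 1 ^ 2 * p 3 * p 4 * p 5 / (p 0 ^ 2 * p 2 ^ 2)
      + 12 * p 1 ^ 4 * p 3 * p 4 * p 5 / (p 0 ^ 2 * p 2 ^ 4) - 4 * p 3 * p 4 * p 5 / p 2 ^ 2
      - 28 * p 1 ^ 2 * p 3 * p 4 * p 5 / p 2 ^ 4) * hG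
  · linear_combination (norm := (field_simp; ring))
      (10 * p 5 / (9 * p 0 ^ 10 * p 1 ^ 2) + 10 * p 5 / (9 * p 0 ^ 8 * p 1 ^ 2 * p 2 ^ 2)) * hF +
      (-6 * p 1 ^ 10 * p 5 ^ 3 / p 0 ^ 12 - 14 * p 1 ^ 8 * p 5 ^ 3 / p 0 ^ 10
      + 10 * p 2 ^ 8 * p 3 ^ 2 * p 5 / (p 0 ^ 8 * p 1 ^ 2) - 2 * p 2 ^ 6 * p 3 ^ 2 * p 5 / p 0 ^ 8
      + 20 * p 1 ^ 2 * p 2 ^ 4 * p 5 / (9 * p 0 ^ 8)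
      - 12 * p 1 ^ 2 * p 2 ^ 4 * p 3 ^ 2 * p 5 / p 0 ^ 8
      - 10 * p 1 ^ 4 * p 2 ^ 2 * p 5 / (9 * p 0 ^ 8) - 20 * p 1 ^ 6 * p 5 / (9 * p 0 ^ 8)
      - 10 * p 1 ^ 6 * p 5 ^ 3 / p 0 ^ 8 - 4 * p 2 ^ 6 * p 3 ^ 2 * p 5 / (p 0 ^ 6 * p 1 ^ 2)
      + 20 * p 2 ^ 4 * p 5 / (9 * p 0 ^ 6) + 14 * p 1 ^ 2 * p 2 ^ 2 * p 5 / (9 * p 0 ^ 6)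
      - 8 * p 1 ^ 4 * p 5 / (9 * p 0 ^ 6) + 2 * p 1 ^ 2 * p 4 ^ 2 * p 5 / p 0 ^ 4
      + 16 * p 1 ^ 4 * p 4 ^ 2 * p 5 / (p 0 ^ 4 * p 2 ^ 2) - 10 * p 4 ^ 2 * p 5 / p 0 ^ 2
      - 4 * p 1 ^ 2 * p 4 ^ 2 * p 5 / (p 0 ^ 2 * p 2 ^ 2) + 10 * p 4 ^ 2 * p 5 / p 2 ^ 2
      + 4 * p 1 ^ 2 * p 4 ^ 2 * p 5 / p 2 ^ 4) * hG
  · linear_combination (norm := (field_simp; ring))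
      (10 * p 4 / (9 * p 0 ^ 2 * p 1 ^ 8 * p 2 ^ 2) + 10 * p 4 / (9 * p 1 ^ 8 * p 2 ^ 4)) * hF +
      (-18 * p 1 ^ 4 * p 4 * p 5 ^ 2 / (p 0 ^ 4 * p 2 ^ 2)
      - 22 * p 1 ^ 2 * p 4 * p 5 ^ 2 / (p 0 ^ 2 * p 2 ^ 2)
      + 10 * p 2 ^ 6 * p 3 ^ 2 * p 4 / p 1 ^ 8 + 14 * p 2 ^ 4 * p 3 ^ 2 * p 4 / p 1 ^ 6
      + 20 * p 2 ^ 2 * p 4 / (9 * p 1 ^ 4) + 10 * p 4 / (3 * p 1 ^ 2)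
      - 10 * p 4 * p 5 ^ 2 / p 2 ^ 2 - 24 * p 0 ^ 2 * p 2 ^ 4 * p 3 ^ 2 * p 4 / p 1 ^ 8
      + 20 * p 0 ^ 2 * p 2 ^ 2 * p 4 / (9 * p 1 ^ 6)
      - 20 * p 0 ^ 2 * p 2 ^ 2 * p 3 ^ 2 * p 4 / p 1 ^ 6 + 22 * p 0 ^ 2 * p 4 / (9 * p 1 ^ 4)
      - 8 * p 0 ^ 2 * p 4 / (3 * p 1 ^ 2 * p 2 ^ 2) + 6 * p 0 ^ 4 * p 4 ^ 3 / (p 1 ^ 4 * p 2 ^ 2)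
      - 10 * p 0 ^ 6 * p 4 ^ 3 / (p 1 ^ 6 * p 2 ^ 2) - 4 * p 0 ^ 6 * p 4 ^ 3 / (p 1 ^ 4 * p 2 ^ 4)
      + 10 * p 0 ^ 8 * p 4 ^ 3 / (p 1 ^ 6 * p 2 ^ 4)) * hG

/-- Proposition 3.3(iv): the Lie brackets `[X_i, X_j]` vanish at every point of `M̃⁴`. -/
theorem statement_17 (p : E6) (hp : p ∈ Mt4) (i j : Fin 3) (hij : i ≠ j) :
    fderiv ℝ (Xv j) p (Xv i p) - fderiv ℝ (Xv i) p (Xv j p) = 0 := by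
  obtain ⟨⟨hF, hG, h0, h1, h2, -⟩, -⟩ := hp
  have h12 := bracket_X1_X2 hF hG h0.ne' h1.ne' h2.ne'
  have h13 := bracket_X1_X3 hF hG h0.ne' h1.ne' h2.ne'
  have h23 := bracket_X2_X3 hF hG h0.ne' h1.ne' h2.ne'
  have h21 := neg_eq_zero.2 h12
  have h31 := neg_eq_zero.2 h13
  have h32 := neg_eq_zero.2 h23
  rw [neg_sub] at h21 h31 h32
  fin_cases i <;> fin_cases j <;> first | exact absurd rfl hij | assumption
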